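/- arXiv:1807.09105 — 4 statements merged into one kernel-verified Lean document; each statement's English description precedes it below -/
import Mathlib

section
/- Let k be a field of characteristic zero and let D be a non-zero k-derivation on k[x,y] such that D(x) and D(y) are monomials, D(x) is monic, gcd(D(x), D(y)) = 1, and deg D(x) ≤ deg D(y) whenever D(y) ≠ 0. If k[x,y]^D = k and k(x,y)^D ≠ k, then D is one of the following: (1) D = ∂/∂x + a·x^m·y^{n+1} ∂/∂y with m ≥ 0, n > 0 integers and a ∈ k*; (2) D = x^{m+1} ∂/∂x + a·y^{n+1} ∂/∂y with m, n > 0 integers, m ≤ n, and a ∈ k*; (3) D = x ∂/∂x + a·y ∂/∂y with a a positive rational number (viewed in k). -/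
namespace MonomialDerivation

section OneVariable

open Polynomial

variable {k : Type*} [Field k] [CharZero k]

/-- The coefficient of `X (f' g - f g')` in degree `deg f + deg g`. -/
theorem coeff_X_mul_wronskian (f g : k[X]) :
    (X * (derivative f * g - f * derivative g)).coeff (f.natDegree + g.natDegree)
      = ((f.natDegree : k) - g.natDegree) * (f.leadingCoeff * g.leadingCoeff) := by
  have hX : ∀ p : k[X], (X * derivative p).natDegree ≤ p.natDegree ∧
      (X * derivative p).coeff p.natDegree = p.natDegree * p.leadingCoeff := by
    intro p
    have hc : ∀ n, (X * derivative p).coeff n = n * p.coeff n := by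
      intro n
      cases n with
      | zero => simp
      | succ n => rw [coeff_X_mul, coeff_derivative]; push_cast; ring
    refine ⟨natDegree_le_iff_coeff_eq_zero.2 fun n hn => ?_, hc _⟩
    rw [hc, coeff_eq_zero_of_natDegree_lt hn, mul_zero]
  rw [show X * (derivative f * g - f * derivative g)
      = (X * derivative f) * g - f * (X * derivative g) by ring, coeff_sub,
    coeff_mul_add_eq_of_natDegree_le (hX f).1 le_rfl,
    coeff_mul_add_eq_of_natDegree_le le_rfl (hX g).1, (hX f).2, (hX g).2]
  simp only [coeff_natDegree]
  ring

theorem eq_C_mul_of_derivative_mul_eq {f g : k[X]} (hg : g ≠ 0)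
    (h : derivative f * g = f * derivative g) : ∃ c : k, f = C c * g := by
  have key : ∀ {p : k[X]}, p ≠ 0 → derivative p * g = p * derivative g →
      p.natDegree = g.natDegree := by
    intro p hp hpg
    have := coeff_X_mul_wronskian p g
    rw [hpg, sub_self, mul_zero, coeff_zero] at this
    have h0 : p.leadingCoeff * g.leadingCoeff ≠ 0 := by simp [hp, hg]
    have := (mul_eq_zero.1 this.symm).resolve_right h0
    exact_mod_cast sub_eq_zero.1 this
  refine ⟨f.coeff g.natDegree / g.leadingCoeff, ?_⟩
  by_contra hne
  have hp := sub_ne_zero.2 hne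
  have hd := key hp (by simp only [derivative_sub, derivative_C_mul]; linear_combination h)
  apply hp
  rw [← leadingCoeff_eq_zero, leadingCoeff, hd, coeff_sub, coeff_C_mul, coeff_natDegree,
    div_mul_cancel₀ _ (leadingCoeff_ne_zero.2 hg), sub_self]

/-- `p ↦ p' + m a X ^ r p` on `k[X]`: the parameter `m` is determined. -/
theorem eq_of_derivative_wronskian_eq {a : k} (ha : a ≠ 0) (r : ℕ) {f g : k[X]} (hf : f ≠ 0)
    (hg : g ≠ 0) {m n : ℕ}
    (h : derivative f * g - f * derivative g
      = ((n : k[X]) - (m : k[X])) * (C a * X ^ r) * (f * g)) : m = n := by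
  by_contra hmn
  have hc : ((n : k) - m) * a ≠ 0 :=
    mul_ne_zero (sub_ne_zero.2 (by exact_mod_cast (Ne.symm hmn))) ha
  have h' : X * (derivative f * g - f * derivative g)
      = C (((n : k) - m) * a) * (f * g) * X ^ (r + 1) := by
    rw [h]; simp only [C_mul, C_sub, C_eq_natCast]; ring
  have hdeg : (X * (derivative f * g - f * derivative g)).natDegree
      ≤ f.natDegree + g.natDegree := by
    rw [show X * (derivative f * g - f * derivative g)
      = (X * derivative f) * g - f * (X * derivative g) by ring]
    have hX : ∀ p : k[X], (X * derivative p).natDegree ≤ p.natDegree := by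
      intro p
      refine natDegree_le_iff_coeff_eq_zero.2 fun j hj => ?_
      cases j with
      | zero => simp
      | succ j => rw [coeff_X_mul, coeff_derivative, coeff_eq_zero_of_natDegree_lt hj, zero_mul]
    refine (natDegree_sub_le _ _).trans (max_le ?_ ?_)
    · exact natDegree_mul_le.trans (Nat.add_le_add_right (hX f) _)
    · exact natDegree_mul_le.trans (Nat.add_le_add_left (hX g) _)
  rw [h', natDegree_mul_X_pow _ (mul_ne_zero (C_ne_zero.2 hc) (mul_ne_zero hf hg)),
    natDegree_C_mul hc, natDegree_mul hf hg] at hdeg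
  omega

/-- `p ↦ a X ^ (r + 2) p' + m p` on `k[X]`: the parameter `m` is determined. -/
theorem eq_of_X_pow_mul_wronskian_eq {a : k} (r : ℕ) {f g : k[X]} (hf : f ≠ 0)
    (hg : g ≠ 0) {m n : ℕ}
    (h : C a * X ^ (r + 2) * (derivative f * g - f * derivative g)
      = ((n : k[X]) - (m : k[X])) * 1 * (f * g)) : m = n := by
  by_contra hmn
  have hc : ((n : k) - m) ≠ 0 := sub_ne_zero.2 (by exact_mod_cast (Ne.symm hmn))
  have hX : ∀ p : k[X], X ^ p.natTrailingDegree ∣ X * derivative p := by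
    intro p
    refine X_pow_dvd_iff.2 fun j hj => ?_
    cases j with
    | zero => simp
    | succ j => rw [coeff_X_mul, coeff_derivative, coeff_eq_zero_of_lt_natTrailingDegree hj,
        zero_mul]
  have hX' : ∀ p : k[X], X ^ p.natTrailingDegree ∣ p := fun p =>
    X_pow_dvd_iff.2 fun j hj => coeff_eq_zero_of_lt_natTrailingDegree hj
  have hdvd : X ^ (f.natTrailingDegree + g.natTrailingDegree + 1) ∣ f * g := by
    have h1 : C ((n : k) - m) * (f * g)
        = C a * X ^ r * X * ((X * derivative f) * g - f * (X * derivative g)) := by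
      simp only [C_sub, C_eq_natCast]; linear_combination -h
    have h2 : X ^ (f.natTrailingDegree + g.natTrailingDegree + 1)
        ∣ C ((n : k) - m) * (f * g) := by
      rw [h1, pow_succ', mul_assoc (C a * X ^ r)]
      refine Dvd.dvd.mul_left (mul_dvd_mul_left X ?_) _
      rw [pow_add]
      exact dvd_sub (mul_dvd_mul (hX f) (hX' g)) (mul_dvd_mul (hX' f) (hX g))
    exact (IsUnit.dvd_mul_left (isUnit_C.2 hc.isUnit)).1 h2
  have := X_pow_dvd_iff.1 hdvd _ (Nat.lt_succ_self _)
  rw [coeff_mul_natTrailingDegree_add_natTrailingDegree] at this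
  simp [hf, hg] at this

/-- `p ↦ X p' + m a p` on `k[X]` with `a` irrational: the parameter `m` is determined. -/
theorem eq_of_X_mul_wronskian_eq {a : k} (ha : ∀ q : ℚ, a ≠ q) {f g : k[X]} (hf : f ≠ 0)
    (hg : g ≠ 0) {m n : ℕ}
    (h : X * (derivative f * g - f * derivative g)
      = ((n : k[X]) - (m : k[X])) * C a * (f * g)) : m = n := by
  by_contra hmn
  have hc : ((n : k) - m) ≠ 0 := sub_ne_zero.2 (by exact_mod_cast (Ne.symm hmn))
  have := coeff_X_mul_wronskian f g
  rw [h, show ((n : k[X]) - (m : k[X])) * C a * (f * g) = C (((n : k) - m) * a) * (f * g) by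
    simp only [C_mul, C_sub, C_eq_natCast], coeff_C_mul, coeff_mul_degree_add_degree] at this
  have := mul_right_cancel₀ (by simp [hf, hg]) this
  refine ha (((f.natDegree : ℚ) - g.natDegree) / ((n : ℚ) - m)) ?_
  push_cast
  rw [eq_div_iff hc, ← this, mul_comm]

/-- If a map `E` of `k[X][Y]` acts on the coefficient of `Y ^ n` as `A d/dX + n b`, and if these
operators are distinguished by their solutions, then `E` has only constants in its rational
kernel. -/
theorem eq_C_C_mul {A b : k[X]} (hA : A ≠ 0)
    (H : ∀ f g : k[X], f ≠ 0 → g ≠ 0 → ∀ m n : ℕ,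
      A * (derivative f * g - f * derivative g) = ((n : k[X]) - (m : k[X])) * b * (f * g) → m = n)
    (E : k[X][X] → k[X][X])
    (hE : ∀ p n, (E p).coeff n = A * derivative (p.coeff n) + n * b * p.coeff n)
    {F G : k[X][X]} (hG : G ≠ 0) (h : E F * G = F * E G) :
    ∃ c : k, F = C (C c) * G := by
  have hdeg : ∀ p, (E p).natDegree ≤ p.natDegree := fun p =>
    natDegree_le_iff_coeff_eq_zero.2 fun n hn => by
      rw [hE, coeff_eq_zero_of_natDegree_lt hn]; simp
  have key : ∀ {P : k[X][X]}, P ≠ 0 → E P * G = P * E G → P.natDegree = G.natDegree ∧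
      derivative P.leadingCoeff * G.leadingCoeff
        = P.leadingCoeff * derivative G.leadingCoeff := by
    intro P hP hPG
    have h1 := congrArg (fun q => q.coeff (P.natDegree + G.natDegree)) hPG
    rw [coeff_mul_add_eq_of_natDegree_le (hdeg P) le_rfl,
      coeff_mul_add_eq_of_natDegree_le le_rfl (hdeg G), hE, hE] at h1
    simp only [coeff_natDegree] at h1
    have hmn := H P.leadingCoeff G.leadingCoeff (leadingCoeff_ne_zero.2 hP)
      (leadingCoeff_ne_zero.2 hG) P.natDegree G.natDegree (by linear_combination h1)
    refine ⟨hmn, mul_left_cancel₀ hA ?_⟩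
    rw [hmn] at h1
    linear_combination h1
  rcases eq_or_ne F 0 with rfl | hF
  · exact ⟨0, by simp⟩
  obtain ⟨c, hc⟩ := eq_C_mul_of_derivative_mul_eq (leadingCoeff_ne_zero.2 hG) (key hF h).2
  refine ⟨c, ?_⟩
  by_contra hne
  have hp := sub_ne_zero.2 hne
  have hEsub : E (F - C (C c) * G) = E F - C (C c) * E G := by
    ext1 n
    rw [hE, coeff_sub, coeff_sub, coeff_C_mul, coeff_C_mul, hE, hE, derivative_sub,
      derivative_C_mul]
    ring
  have hd := (key hp (by rw [hEsub]; linear_combination h)).1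
  apply hp
  rw [← leadingCoeff_eq_zero, leadingCoeff, hd, coeff_sub, coeff_C_mul, coeff_natDegree,
    ← (key hF h).1, coeff_natDegree, hc, sub_self]

end OneVariable

section TwoVariables

open MvPolynomial

variable {k : Type*} [Field k]

/-- Coefficientwise description of a derivation transported to `k[X][Y]`. -/
theorem coeff_symm_derivation {A b : Polynomial k}
    (D : Derivation k (MvPolynomial (Fin 2) k) (MvPolynomial (Fin 2) k))
    (e : Polynomial (Polynomial k) ≃ₐ[k] MvPolynomial (Fin 2) k)
    (hX : D (e (Polynomial.C Polynomial.X)) = e (Polynomial.C A))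
    (hY : D (e Polynomial.X) = e (Polynomial.C b * Polynomial.X))
    (p : Polynomial (Polynomial k)) (n : ℕ) :
    (e.symm (D (e p))).coeff n
      = A * Polynomial.derivative (p.coeff n) + n * b * p.coeff n := by
  induction p using Polynomial.induction_on' with
  | add p q hp hq =>
    simp only [map_add, Polynomial.coeff_add, hp, hq]; ring
  | monomial t f =>
    induction f using Polynomial.induction_on' with
    | add p q hp hq =>
      simp only [map_add, Polynomial.coeff_add, hp, hq]; ring
    | monomial s a =>
      have h1 : (Polynomial.monomial t (Polynomial.monomial s a) : Polynomial (Polynomial k))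
          = a • ((Polynomial.C Polynomial.X) ^ s * Polynomial.X ^ t) := by
        rw [← Polynomial.C_mul_X_pow_eq_monomial, ← Polynomial.C_mul_X_pow_eq_monomial,
          Polynomial.C_mul, Polynomial.C_pow, mul_assoc, Algebra.smul_def]
        rfl
      have h2 : e.symm (D (e (Polynomial.monomial t (Polynomial.monomial s a))))
          = Polynomial.monomial t (A * Polynomial.derivative (Polynomial.monomial s a)
            + t * b * Polynomial.monomial s a) := by
        rw [h1]
        simp only [map_smul, map_mul, map_pow, Derivation.map_smul, Derivation.leibniz,
          Derivation.leibniz_pow, hX, hY, map_add, smul_eq_mul, nsmul_eq_mul,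
          map_natCast, AlgEquiv.symm_apply_apply]
        simp only [← Polynomial.C_mul_X_pow_eq_monomial]
        rw [Algebra.smul_def, IsScalarTower.algebraMap_apply k (Polynomial k),
          Polynomial.algebraMap_eq, Polynomial.algebraMap_eq]
        cases s <;> cases t <;> simp <;> ring
      rw [h2, Polynomial.coeff_monomial, Polynomial.coeff_monomial]
      split_ifs with h
      · rw [h]
      · simp

theorem exists_eq_algebraMap_of_derivation_eq_zero [CharZero k] {K : Type*} [Field K]
    [Algebra (MvPolynomial (Fin 2) k) K]
    [IsFractionRing (MvPolynomial (Fin 2) k) K]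
    [Algebra k K] [IsScalarTower k (MvPolynomial (Fin 2) k) K]
    {D : Derivation k (MvPolynomial (Fin 2) k) (MvPolynomial (Fin 2) k)}
    {D' : Derivation k K K}
    (hD' : ∀ p : MvPolynomial (Fin 2) k,
      D' (algebraMap (MvPolynomial (Fin 2) k) K p)
        = algebraMap (MvPolynomial (Fin 2) k) K (D p))
    (e : Polynomial (Polynomial k) ≃ₐ[k] MvPolynomial (Fin 2) k) {A b : Polynomial k}
    (hA : A ≠ 0)
    (H : ∀ f g : Polynomial k, f ≠ 0 → g ≠ 0 → ∀ m n : ℕ,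
      A * (Polynomial.derivative f * g - f * Polynomial.derivative g)
        = ((n : Polynomial k) - m) * b * (f * g) → m = n)
    (hX : D (e (Polynomial.C Polynomial.X)) = e (Polynomial.C A))
    (hY : D (e Polynomial.X) = e (Polynomial.C b * Polynomial.X))
    {u : K} (hu : D' u = 0) : ∃ c : k, u = algebraMap k K c := by
  obtain ⟨f, g, hg, rfl⟩ := IsFractionRing.div_surjective (A := MvPolynomial (Fin 2) k) u
  have hg0 : g ≠ 0 := nonZeroDivisors.ne_zero hg
  have hinj := IsFractionRing.injective (MvPolynomial (Fin 2) k) K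
  have hgK : algebraMap (MvPolynomial (Fin 2) k) K g ≠ 0 := by
    rwa [Ne, map_eq_zero_iff _ hinj]
  have hfg : D f * g = f * D g := by
    apply hinj
    have h1 := hD' f
    rw [← div_mul_cancel₀ (algebraMap (MvPolynomial (Fin 2) k) K f) hgK, Derivation.leibniz, hu,
      hD' g, smul_zero, add_zero, smul_eq_mul] at h1
    rw [map_mul, map_mul, ← h1]
    field_simp
  obtain ⟨c, hc⟩ := eq_C_C_mul hA H (fun p => e.symm (D (e p)))
    (coeff_symm_derivation D e hX hY) (F := e.symm f) (G := e.symm g)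
    (by simpa using hg0) (by simp only [AlgEquiv.apply_symm_apply, ← map_mul, hfg])
  refine ⟨c, ?_⟩
  have hfc : f = algebraMap k _ c * g := by
    apply e.symm.injective
    rw [hc, map_mul, AlgEquiv.commutes]
    rfl
  rw [hfc, map_mul, mul_div_cancel_right₀ _ hgK, ← IsScalarTower.algebraMap_apply]

/-- A derivation of `k[x,y]` whose kernel is `k` kills no polynomial that evaluates to different
values at two points. -/
theorem false_of_derivation_eq_zero {σ : Type*}
    {D : Derivation k (MvPolynomial σ k) (MvPolynomial σ k)}
    (hker : ∀ f : MvPolynomial σ k, D f = 0 → ∃ c : k, f = C c)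
    {f : MvPolynomial σ k} (hf : D f = 0) (v w : σ → k)
    (hvw : eval v f ≠ eval w f) : False := by
  obtain ⟨c, rfl⟩ := hker f hf
  simp at hvw

/-- A derivation of `k[x,y]` is determined by its values on the variables. -/
theorem derivation_eq_smul_pderiv
    {D : Derivation k (MvPolynomial (Fin 2) k) (MvPolynomial (Fin 2) k)}
    {p q : MvPolynomial (Fin 2) k} (h0 : D (X 0) = p) (h1 : D (X 1) = q) :
    D = p • pderiv 0 + q • pderiv 1 := by
  ext i : 1
  fin_cases i <;> simp [h0, h1, pderiv_X]

end TwoVariables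

end MonomialDerivation

open MvPolynomial MonomialDerivation

/-- **Theorem 4.1.** Let `k` be a field of characteristic zero and `D` a non-zero monomial
`k`-derivation on `k[x,y]` with `D x` monic, `gcd (D x, D y) = 1` and
`deg (D x) ≤ deg (D y)` whenever `D y ≠ 0`.  If `k[x,y]^D = k` and `k(x,y)^D ≠ k`, then `D`
is one of: (1) `∂x + a x^m y^(n+1) ∂y` with `m ≥ 0`, `n > 0`, `a ∈ k*`;
(2) `x^(m+1) ∂x + a y^(n+1) ∂y` with `0 < m ≤ n`, `a ∈ k*`;
(3) `x ∂x + a y ∂y` with `a` a positive rational number. -/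
theorem monomial_derivation_with_nontrivial_rational_kernel
    (k : Type*) [Field k] [CharZero k]
    (K : Type*) [Field K] [Algebra (MvPolynomial (Fin 2) k) K]
    [IsFractionRing (MvPolynomial (Fin 2) k) K]
    [Algebra k K] [IsScalarTower k (MvPolynomial (Fin 2) k) K]
    (D : Derivation k (MvPolynomial (Fin 2) k) (MvPolynomial (Fin 2) k))
    (hD : D ≠ 0)
    (hmonx : ∃ i j : ℕ, D (X 0) = X 0 ^ i * X 1 ^ j)
    (hmony : ∃ (a : k) (i j : ℕ), D (X 1) = C a * X 0 ^ i * X 1 ^ j)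
    (hgcd : IsRelPrime (D (X 0)) (D (X 1)))
    (hdeg : D (X 1) ≠ 0 → (D (X 0)).totalDegree ≤ (D (X 1)).totalDegree)
    (hker : ∀ f : MvPolynomial (Fin 2) k, D f = 0 → ∃ c : k, f = C c)
    (D' : Derivation k K K)
    (hD' : ∀ p : MvPolynomial (Fin 2) k,
      D' (algebraMap (MvPolynomial (Fin 2) k) K p)
        = algebraMap (MvPolynomial (Fin 2) k) K (D p))
    (hker' : ∃ u : K, D' u = 0 ∧ ∀ c : k, u ≠ algebraMap k K c) :
    (∃ (m n : ℕ) (a : k), 0 < n ∧ a ≠ 0 ∧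
        D = pderiv 0 + (C a * X 0 ^ m * X 1 ^ (n + 1) : MvPolynomial (Fin 2) k) • pderiv 1)
    ∨ (∃ (m n : ℕ) (a : k), 0 < m ∧ 0 < n ∧ m ≤ n ∧ a ≠ 0 ∧
        D = (X 0 ^ (m + 1) : MvPolynomial (Fin 2) k) • pderiv 0
              + (C a * X 1 ^ (n + 1) : MvPolynomial (Fin 2) k) • pderiv 1)
    ∨ (∃ a : ℚ, 0 < a ∧
        D = (X 0 : MvPolynomial (Fin 2) k) • pderiv 0
              + (C (a : k) * X 1 : MvPolynomial (Fin 2) k) • pderiv 1) := by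
  obtain ⟨i, j, hx⟩ := hmonx
  obtain ⟨a, p, q, hy⟩ := hmony
  obtain ⟨u, hu0, hu⟩ := hker'
  have ha : a ≠ 0 := by
    rintro rfl
    exact false_of_derivation_eq_zero hker (f := X 1) (by simp [hy]) ![0, 0] ![0, 1] (by simp)
  have hmon : ∀ (c : k) (r s : ℕ), c ≠ 0 →
      (C c * X 0 ^ r * X 1 ^ s : MvPolynomial (Fin 2) k).totalDegree = r + s := by
    intro c r s hc
    rw [totalDegree_mul_of_isDomain (by simp [hc]) (by simp),
      totalDegree_mul_of_isDomain (by simp [hc]) (by simp)]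
    simp
  have hdeg' : i + j ≤ p + q := by
    have h1 := hmon a p q ha
    have h2 := hmon 1 i j one_ne_zero
    rw [C_1, one_mul] at h2
    rw [hx, hy, h1, h2] at hdeg
    exact hdeg (by simp [ha])
  have hcop : ∀ v : Fin 2, X v ∣ D (X 0) → X v ∣ D (X 1) → False := fun v h0 h1 =>
    X_prime.not_isUnit (hgcd h0 h1)
  have hip : i = 0 ∨ p = 0 := by
    by_contra! h
    exact hcop 0 (by rw [hx]; exact (dvd_pow_self _ h.1).mul_right _)
      (by rw [hy]; exact ((dvd_pow_self _ h.2).mul_left _).mul_right _)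
  have hjq : j = 0 ∨ q = 0 := by
    by_contra! h
    exact hcop 1 (by rw [hx]; exact (dvd_pow_self _ h.1).mul_left _)
      (by rw [hy]; exact (dvd_pow_self _ h.2).mul_left _)
  have hi0 : q = 0 → i ≠ 0 := by
    rintro rfl rfl
    refine false_of_derivation_eq_zero hker
      (f := C ((p + 1 : ℕ) : k) * X 1 ^ (j + 1) - C (((j + 1 : ℕ) : k) * a) * X 0 ^ (p + 1))
      ?_ ![0, 0] ![0, 1] ?_
    · simp only [map_sub, Derivation.leibniz, derivation_C, Derivation.leibniz_pow, hx, hy,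
        smul_eq_mul, nsmul_eq_mul, C_mul, map_natCast,
        Derivation.map_natCast, Nat.add_sub_cancel, pow_zero]
      ring
    · simpa using (Nat.cast_add_one_ne_zero (R := k) p).symm
  have hconst : ∀ {A b : Polynomial k}
      (e : Polynomial (Polynomial k) ≃ₐ[k] MvPolynomial (Fin 2) k), A ≠ 0 →
      (∀ f g : Polynomial k, f ≠ 0 → g ≠ 0 → ∀ m n : ℕ,
        A * (Polynomial.derivative f * g - f * Polynomial.derivative g)
          = ((n : Polynomial k) - m) * b * (f * g) → m = n) →
      D (e (Polynomial.C Polynomial.X)) = e (Polynomial.C A) →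
      D (e Polynomial.X) = e (Polynomial.C b * Polynomial.X) → False := by
    intro A b e hA H hX hY
    obtain ⟨c, hc⟩ := exists_eq_algebraMap_of_derivation_eq_zero hD' e hA H hX hY hu0
    exact hu c hc
  rcases Nat.eq_zero_or_pos i with rfl | hi
  · have hq : q ≠ 0 := fun h => hi0 h rfl
    obtain rfl : j = 0 := hjq.resolve_right hq
    left
    rcases q with _ | _ | n
    · exact absurd rfl hq
    · exact (hconst (A := 1) (b := Polynomial.C a * Polynomial.X ^ p)
        (Polynomial.Bivariate.equivMvPolynomial k) one_ne_zero
        (fun f g hf hg m n h => eq_of_derivative_wronskian_eq ha p hf hg (by rwa [one_mul] at h))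
        (by simp [hx]) (by simp [hy])).elim
    · refine ⟨p, n + 1, a, n.succ_pos, ha, ?_⟩
      simpa using derivation_eq_smul_pderiv hx hy
  obtain rfl : p = 0 := hip.resolve_left hi.ne'
  have hq : q ≠ 0 := by omega
  obtain rfl : j = 0 := hjq.resolve_right hq
  rw [pow_zero, mul_one] at hx hy
  obtain ⟨i, rfl⟩ := Nat.exists_eq_add_one_of_ne_zero hi.ne'
  obtain ⟨q, rfl⟩ := Nat.exists_eq_add_one_of_ne_zero hq
  right
  rcases i with _ | i
  · rcases q with _ | q
    · right
      rw [zero_add, pow_one] at hx hy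
      by_cases hrat : ∃ r : ℚ, a = r
      · obtain ⟨r, rfl⟩ := hrat
        refine ⟨r, ?_, derivation_eq_smul_pderiv hx hy⟩
        by_contra hr
        have hr0 : r ≠ 0 := by rintro rfl; simp at ha
        have hneg : r < 0 := lt_of_le_of_ne (not_lt.1 hr) hr0
        have hnum : 0 < -r.num := by simpa using hneg
        obtain ⟨s, hs⟩ := Int.eq_ofNat_of_zero_le hnum.le
        have hs0 : s ≠ 0 := by omega
        have hrel : (s : k) + r.den * (r : k) = 0 := by
          have : (s : ℚ) + r.den * r = 0 := by
            have h1 : (r.num : ℚ) = -s := by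
              have : r.num = -(s : ℤ) := by omega
              rw [this]; simp
            rw [mul_comm, Rat.mul_den_eq_num, h1]; ring
          exact_mod_cast congrArg (Rat.cast : ℚ → k) this
        refine false_of_derivation_eq_zero hker (f := X 0 ^ s * X 1 ^ r.den) ?_
          ![0, 0] ![1, 1] (by simp [hs0])
        have hrelC : (s : MvPolynomial (Fin 2) k) + (r.den : MvPolynomial (Fin 2) k) * C (r : k) = 0 := by
          rw [← map_natCast C, ← map_natCast C, ← C_mul, ← C_add, hrel, C_0]
        simp only [Derivation.leibniz, Derivation.leibniz_pow, hx, hy, smul_eq_mul, nsmul_eq_mul]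
        have h1 := pow_sub_one_mul hs0 (X 0 : MvPolynomial (Fin 2) k)
        have h2 := pow_sub_one_mul r.den_nz (X 1 : MvPolynomial (Fin 2) k)
        linear_combination (X 1 ^ r.den * (s : MvPolynomial (Fin 2) k)) * h1
          + (X 0 ^ s * (r.den : MvPolynomial (Fin 2) k) * C (r : k)) * h2
          + X 0 ^ s * X 1 ^ r.den * hrelC
      · push Not at hrat
        exact (hconst (A := Polynomial.X) (b := Polynomial.C a)
          (Polynomial.Bivariate.equivMvPolynomial k) Polynomial.X_ne_zero
          (fun f g hf hg m n h => eq_of_X_mul_wronskian_eq hrat hf hg h)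
          (by simp [hx]) (by simp [hy])).elim
    · exact (hconst (A := Polynomial.C a * Polynomial.X ^ (q + 2)) (b := 1)
        ((Polynomial.Bivariate.equivMvPolynomial k).trans (renameEquiv k (Equiv.swap 0 1)))
        (by simp [ha])
        (fun f g hf hg m n h => eq_of_X_pow_mul_wronskian_eq q hf hg h)
        (by simp [hy]) (by simp [hx])).elim
  · left
    exact ⟨i + 1, q, a, i.succ_pos, by omega, by omega, ha, derivation_eq_smul_pderiv hx hy⟩
end

section
/- Let R be an integral domain of characteristic zero and let f ∈ R[x_1,…,x_n] be a non-constant polynomial whose total degree is a prime number, and such that Q(R)[f] ∩ R[x_1,…,x_n] = R[f]. Then f is a closed polynomial if and only if deg f̂ < deg f − 1, where f̂ = gcd(f_{x_1},…,f_{x_n}) is the greatest common divisor of the partial derivatives of f, computed in the polynomial ring Q(R)[x_1,…,x_n] over the fraction field Q(R) of R. -/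
namespace MvPolynomial

theorem IsHomogeneous.aeval_C_mul_X {σ K : Type*} [CommRing K] {G : MvPolynomial σ K} {j : ℕ}
    (hG : G.IsHomogeneous j) (c : σ → K) :
    MvPolynomial.aeval (fun i ↦ Polynomial.C (c i) * Polynomial.X) G =
      Polynomial.C (MvPolynomial.eval c G) * Polynomial.X ^ j := by
  rw [aeval_def, eval₂_eq, eval_eq, map_sum, Finset.sum_mul]
  refine Finset.sum_congr rfl fun d hd ↦ ?_
  have hdj : ∑ i ∈ d.support, d i = j := by
    simpa [Finsupp.weight_apply, Finsupp.sum] using hG (mem_support_iff.mp hd)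
  simp [mul_pow, Finset.prod_mul_distrib, Finset.prod_pow_eq_pow_sum, hdj, mul_assoc]

theorem exists_natDegree_aeval_C_mul_X_eq {σ K : Type*} [CommRing K] [IsDomain K] [Infinite K]
    {F : MvPolynomial σ K} (hF : F ≠ 0) :
    ∃ c : σ → K, (aeval (fun i ↦ Polynomial.C (c i) * Polynomial.X) F).natDegree =
      F.totalDegree := by
  have htop : homogeneousComponent F.totalDegree F ≠ 0 := by
    obtain ⟨d, hd, hdeg⟩ := Finset.exists_mem_eq_sup F.support (support_nonempty.mpr hF)
      (fun s ↦ s.sum fun _ e ↦ e)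
    intro h
    have := congrArg (coeff d) h
    rw [coeff_homogeneousComponent, if_pos, coeff_zero] at this
    · exact mem_support_iff.mp hd this
    · exact hdeg.symm
  obtain ⟨c, hc⟩ : ∃ c, eval c (homogeneousComponent F.totalDegree F) ≠ 0 := by
    by_contra! h
    exact htop (funext fun c ↦ by simpa using h c)
  refine ⟨c, Polynomial.natDegree_eq_of_le_of_coeff_ne_zero ?_ ?_⟩
  · conv_lhs => rw [← sum_homogeneousComponent F]
    rw [map_sum]
    refine Polynomial.natDegree_sum_le_of_forall_le _ _ fun j hj ↦ ?_
    rw [(homogeneousComponent_isHomogeneous j F).aeval_C_mul_X]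
    exact (Polynomial.natDegree_C_mul_X_pow_le _ _).trans (Nat.lt_succ_iff.mp (Finset.mem_range.mp hj))
  · nth_rw 1 [← sum_homogeneousComponent F]
    simp only [map_sum, (homogeneousComponent_isHomogeneous _ F).aeval_C_mul_X,
      Polynomial.finsetSum_coeff, Polynomial.coeff_C_mul_X_pow]
    rw [Finset.sum_ite_eq]
    simpa using hc

theorem totalDegree_polynomial_aeval {σ K : Type*} [CommRing K] [IsDomain K]
    (L : MvPolynomial σ K) (u : Polynomial K) :
    (Polynomial.aeval L u).totalDegree = u.natDegree * L.totalDegree := by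
  rcases Nat.eq_zero_or_pos L.totalDegree with hL | hL
  · obtain ⟨c, hc⟩ : ∃ c, L = C c := ⟨_, totalDegree_eq_zero_iff_eq_C.mp hL⟩
    have : Polynomial.aeval (C c : MvPolynomial σ K) u = C (u.eval c) :=
      Polynomial.aeval_algebraMap_apply_eq_algebraMap_eval c u
    rw [hL, hc, this, totalDegree_C, mul_zero]
  induction hk : u.natDegree generalizing u with
  | zero =>
    rw [Polynomial.eq_C_of_natDegree_eq_zero hk, Polynomial.aeval_C, algebraMap_eq, totalDegree_C,
      zero_mul]
  | succ k ih =>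
    have hdiv : u.divX.natDegree = k := by rw [Polynomial.natDegree_divX_eq_natDegree_tsub_one, hk]; rfl
    have hne : Polynomial.aeval L u.divX ≠ 0 := by
      intro h
      have h0 := ih _ hdiv
      rw [h, totalDegree_zero] at h0
      obtain rfl : k = 0 := by
        rcases Nat.mul_eq_zero.mp h0.symm with h | h <;> omega
      rw [Polynomial.eq_C_of_natDegree_eq_zero hdiv, Polynomial.aeval_C, algebraMap_eq,
        C_eq_zero, Polynomial.coeff_divX] at h
      have : u = 0 := by
        rw [← Polynomial.leadingCoeff_eq_zero, Polynomial.leadingCoeff, hk, h]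
      simp [this] at hk
    have hL0 : L ≠ 0 := by rintro rfl; simp at hL
    have hmul := totalDegree_mul_of_isDomain hne hL0
    conv_lhs => rw [← Polynomial.divX_mul_X_add u]
    rw [map_add, map_mul, Polynomial.aeval_X, Polynomial.aeval_C, algebraMap_eq,
      totalDegree_add_eq_left_of_totalDegree_lt, hmul, ih _ hdiv]
    · ring
    · rw [hmul, totalDegree_C]; omega

theorem pderiv_polynomial_aeval {σ K : Type*} [CommRing K]
    (L : MvPolynomial σ K) (u : Polynomial K) (i : σ) :
    pderiv i (Polynomial.aeval L u) = Polynomial.aeval L (Polynomial.derivative u) * pderiv i L := by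
  simp

theorem pderiv_pderiv_comm {σ K : Type*} [CommRing K] (i j : σ) (F : MvPolynomial σ K) :
    pderiv i (pderiv j F) = pderiv j (pderiv i F) := by
  classical
  let D (i : σ) : Derivation K (MvPolynomial σ K) (MvPolynomial σ K) := pderiv i
  have h : ⁅D i, D j⁆ = 0 := by
    refine derivation_ext fun l ↦ ?_
    simp [D, Derivation.commutator_apply, pderiv_X, Pi.single_apply, apply_ite]
  simpa [D, Derivation.commutator_apply, sub_eq_zero] using DFunLike.congr_fun h F

theorem totalDegree_pderiv_lt {σ K : Type*} [CommRing K] {F : MvPolynomial σ K}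
    (hF : F.totalDegree ≠ 0) (i : σ) : (pderiv i F).totalDegree < F.totalDegree := by
  rw [totalDegree, Finset.sup_lt_iff (Nat.pos_of_ne_zero hF)]
  intro m hm
  rw [mem_support_iff, coeff_pderiv] at hm
  have := le_totalDegree (mem_support_iff.mpr (left_ne_zero_of_mul hm))
  rw [Finsupp.sum_add_index' (by simp) (by simp), Finsupp.sum_single_index rfl] at this
  omega

theorem eq_C_of_forall_pderiv_eq_zero {σ K : Type*} [CommRing K] [IsDomain K] [CharZero K]
    {F : MvPolynomial σ K} (h : ∀ i, pderiv i F = 0) : F = C (coeff 0 F) := by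
  classical
  ext m
  rw [coeff_C]
  split_ifs with hm
  · rw [hm]
  obtain ⟨i, hi⟩ : ∃ i, m i ≠ 0 := by
    by_contra! h0
    exact hm (Finsupp.ext fun i ↦ (h0 i).symm)
  have h1 := coeff_pderiv (i := i) F (m - Finsupp.single i 1)
  rw [h i, coeff_zero, tsub_add_cancel_of_le (by simpa using Nat.one_le_iff_ne_zero.mpr hi)] at h1
  exact (mul_eq_zero.mp h1.symm).resolve_right (Nat.cast_add_one_ne_zero _)

end MvPolynomial

theorem Polynomial.exists_derivative_eq {K : Type*} [Field K] [CharZero K] (u : Polynomial K) :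
    ∃ U : Polynomial K, Polynomial.derivative U = u := by
  induction u using Polynomial.induction_on' with
  | add p q hp hq =>
    obtain ⟨U, rfl⟩ := hp
    obtain ⟨V, rfl⟩ := hq
    exact ⟨U + V, map_add ..⟩
  | monomial k a =>
    refine ⟨Polynomial.monomial (k + 1) (a / (k + 1)), ?_⟩
    have : (k + 1 : K) ≠ 0 := by exact Nat.cast_add_one_ne_zero k
    rw [Polynomial.derivative_monomial]
    simp [this]

namespace MvPolynomial

theorem exists_eq_aeval_of_pderiv_eq_C_mul {σ K : Type*} [Fintype σ] [Field K] [CharZero K]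
    (c : σ → K) {k : σ} (hk : c k ≠ 0) (F d : MvPolynomial σ K)
    (h : ∀ i, pderiv i F = C (c i) * d) :
    ∃ u : Polynomial K, F = Polynomial.aeval (∑ i, C (c i) * X i) u := by
  classical
  induction hN : F.totalDegree using Nat.strong_induction_on generalizing F d with
  | _ N ih =>
    by_cases h0 : F.totalDegree = 0
    · exact ⟨Polynomial.C (coeff 0 F), by
        rw [Polynomial.aeval_C]; exact totalDegree_eq_zero_iff_eq_C.mp h0⟩
    have hck : (C (c k)⁻¹ : MvPolynomial σ K) * C (c k) = 1 := by
      rw [← C_mul, inv_mul_cancel₀ hk, C_1]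
    have hd : d = C (c k)⁻¹ * pderiv k F := by
      rw [h k, ← mul_assoc, hck, one_mul]
    obtain ⟨u, hu⟩ := ih d.totalDegree (by
        rw [hd, ← hN]
        refine (totalDegree_mul _ _).trans_lt ?_
        rw [totalDegree_C, zero_add]
        exact totalDegree_pderiv_lt h0 k) d (C (c k)⁻¹ * pderiv k d) (fun i ↦ by
        have h1 := pderiv_pderiv_comm i k F
        rw [h k, h i, pderiv_C_mul, pderiv_C_mul] at h1
        calc pderiv i d = C (c k)⁻¹ * C (c k) * pderiv i d := by rw [hck, one_mul]
          _ = C (c k)⁻¹ * (C (c k) * pderiv i d) := by ring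
          _ = _ := by rw [h1]; ring) rfl
    obtain ⟨U, hU⟩ := Polynomial.exists_derivative_eq u
    have hlin (i : σ) : pderiv i (∑ i, C (c i) * X i : MvPolynomial σ K) = C (c i) := by
      simp [pderiv_X, Pi.single_apply]
    have hconst := eq_C_of_forall_pderiv_eq_zero
      (F := F - Polynomial.aeval (∑ i, C (c i) * X i) U) (fun i ↦ by
        rw [map_sub, pderiv_polynomial_aeval, hU, ← hu, hlin, h i]; ring)
    refine ⟨U + Polynomial.C (coeff 0 (F - Polynomial.aeval (∑ i, C (c i) * X i) U)), ?_⟩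
    rw [map_add, Polynomial.aeval_C, algebraMap_eq, ← hconst]
    ring

end MvPolynomial

theorem IsIntegral.map_of_forall_mem {R R' S T : Type*} [CommRing R] [CommRing R'] [CommRing S]
    [CommRing T] [Algebra R S] [Algebra R' T] {A : Subalgebra R S} {B : Subalgebra R' T}
    (φ : S →+* T) (hφ : ∀ x ∈ A, φ x ∈ B) {x : S} (hx : IsIntegral A x) :
    IsIntegral B (φ x) :=
  hx.map_of_comp_eq ((φ.comp A.val.toRingHom).codRestrict B fun y ↦ hφ y y.2) φ rfl

theorem AlgHom.apply_mem_adjoin_singleton {R S T : Type*} [CommRing R] [CommRing S] [CommRing T]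
    [Algebra R S] [Algebra R T] (φ : S →ₐ[R] T) {F x : S} (hx : x ∈ Algebra.adjoin R {F}) :
    φ x ∈ Algebra.adjoin R {φ F} := by
  rw [← Set.image_singleton, ← AlgHom.map_adjoin]
  exact ⟨x, hx, rfl⟩

open Polynomial IntermediateField algebraAdjoinAdjoin in
theorem RatFunc.isIntegral_adjoin_singleton_mem {K : Type*} [Field K] {f g : RatFunc K}
    (hf : Transcendental K f) (hg : IsIntegral (Algebra.adjoin K {f}) g)
    (hgf : g ∈ K⟮f⟯) : g ∈ Algebra.adjoin K {f} := by
  have : IsIntegrallyClosed (Algebra.adjoin K {f}) :=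
    .of_equiv (Polynomial.algEquivOfTranscendental K f hf).toRingEquiv
  have hint : IsIntegral (Algebra.adjoin K {f}) (⟨g, hgf⟩ : K⟮f⟯) := by
    obtain ⟨q, hq, hq0⟩ := hg
    refine ⟨q, hq, Subtype.ext ?_⟩
    have := Polynomial.hom_eval₂ q (algebraMap (Algebra.adjoin K {f}) K⟮f⟯) (algebraMap K⟮f⟯ (RatFunc K)) ⟨g, hgf⟩
    exact this.trans hq0
  obtain ⟨y, hy⟩ := IsIntegrallyClosed.isIntegral_iff.mp hint
  have := congrArg (Subtype.val) hy
  rw [algebraAdjoinAdjoin.coe_algebraMap] at this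
  change (y : RatFunc K) = g at this
  exact this ▸ y.2

open IntermediateField in
theorem Polynomial.mem_adjoin_or_exists_eq_X_mul {K : Type*} [Field K] {f g : Polynomial K}
    (hf : f.natDegree.Prime) (hg : IsIntegral (Algebra.adjoin K {f}) g) :
    g ∈ Algebra.adjoin K {f} ∨
      ∃ a ∈ Algebra.adjoin K {f, g}, ∃ b ∈ Algebra.adjoin K {f, g}, b ≠ 0 ∧ a = X * b := by
  let ι : Polynomial K →ₐ[K] RatFunc K := Algebra.algHom K _ _
  have hι : Function.Injective ι := RatFunc.algebraMap_injective K
  have hmap (s : Set (Polynomial K)) (x : RatFunc K) :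
      x ∈ Algebra.adjoin K (ι '' s) ↔ ∃ y ∈ Algebra.adjoin K s, ι y = x := by
    rw [← AlgHom.map_adjoin]; rfl
  have hfr : Module.finrank K⟮ι f⟯ (RatFunc K) = f.natDegree := by
    rw [RatFunc.finrank_eq_max_natDegree]
    change max (algebraMap (Polynomial K) (RatFunc K) f).num.natDegree
      (algebraMap (Polynomial K) (RatFunc K) f).denom.natDegree = _
    rw [RatFunc.num_algebraMap, RatFunc.denom_algebraMap, natDegree_one, Nat.max_zero]
  have := IntermediateField.isSimpleOrder_of_finrank_prime K⟮ι f⟯ (RatFunc K) (hfr ▸ hf)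
  have hf0 : f ≠ 0 := by rintro rfl; exact hf.ne_zero natDegree_zero
  have htr : Transcendental K (ι f) := by
    refine (isAlgebraic_algHom_iff ι hι).not.mpr (f.transcendental hf.ne_zero ?_)
    exact mem_nonZeroDivisors_of_ne_zero (leadingCoeff_ne_zero.mpr hf0)
  rcases eq_bot_or_eq_top (IntermediateField.adjoin K⟮ι f⟯ {ι g}) with h | h
  · left
    have hmem : ι g ∈ K⟮ι f⟯ := by
      rw [IntermediateField.adjoin_simple_eq_bot_iff, IntermediateField.mem_bot] at h
      obtain ⟨y, hy⟩ := h
      exact hy ▸ y.2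
    have hint : IsIntegral (Algebra.adjoin K {ι f}) (ι g) :=
      hg.map_of_forall_mem ι.toRingHom fun _ ↦ ι.apply_mem_adjoin_singleton
    have := RatFunc.isIntegral_adjoin_singleton_mem htr hint hmem
    rw [← Set.image_singleton, hmap] at this
    obtain ⟨y, hy, hyg⟩ := this
    exact hι hyg ▸ hy
  · right
    have hX : ι X ∈ IntermediateField.adjoin K {ι f, ι g} := by
      have : ι X ∈ (IntermediateField.adjoin K⟮ι f⟯ {ι g}).restrictScalars K := by
        rw [h]; trivial
      rwa [IntermediateField.adjoin_simple_adjoin_simple] at this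
    rw [← Set.image_pair] at hX
    obtain ⟨r, hr, s, hs, hrs⟩ := IntermediateField.mem_adjoin_iff_div.mp hX
    obtain ⟨a, ha, rfl⟩ := (hmap _ _).mp hr
    obtain ⟨b, hb, rfl⟩ := (hmap _ _).mp hs
    have hb0 : ι b ≠ 0 := by
      intro h0
      rw [h0, div_zero, map_eq_zero_iff ι hι] at hrs
      exact X_ne_zero hrs
    refine ⟨a, ha, b, hb, fun h0 ↦ hb0 (by rw [h0, map_zero]), hι ?_⟩
    rw [map_mul, hrs, div_mul_cancel₀ _ hb0]


open Polynomial in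
theorem exists_aeval_eq_of_isIntegral_adjoin {K S : Type*} [Field K] [CommRing S] [IsDomain S]
    [IsIntegrallyClosed S] [Algebra K S] (φ : S →ₐ[K] K[X]) {F G : S}
    (hF : (φ F).natDegree.Prime) (hG : IsIntegral (Algebra.adjoin K {F}) G)
    (hGF : G ∉ Algebra.adjoin K {F}) : ∃ L : S, aeval L (φ F) = F := by
  have hF0 : φ F ≠ 0 := by intro h; rw [h] at hF; exact hF.ne_zero natDegree_zero
  have htr : Transcendental K (φ F) := (φ F).transcendental hF.ne_zero
    (mem_nonZeroDivisors_of_ne_zero (leadingCoeff_ne_zero.mpr hF0))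
  have hker (x : S) (hx : IsIntegral (Algebra.adjoin K {F}) x) (hx0 : φ x = 0) : x = 0 := by
    by_contra hne
    obtain ⟨r, hr, hdvd⟩ :=
      hx.isAlgebraic.exists_nonzero_dvd (mem_nonZeroDivisors_of_ne_zero hne)
    obtain ⟨r, hrF⟩ := r
    obtain ⟨q, rfl⟩ := (Algebra.adjoin_singleton_eq_range_aeval K F ▸ hrF :)
    have h0 : φ (aeval F q) = 0 := by
      obtain ⟨y, hy⟩ := hdvd
      change aeval F q = x * y at hy
      rw [hy, map_mul, hx0, zero_mul]
    rw [← aeval_algHom_apply] at h0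
    have hq := transcendental_iff.mp htr q h0
    exact hr (Subtype.ext (by simp [hq]))
  have hint (x : S) (hx : x ∈ Algebra.adjoin K {F, G}) : IsIntegral (Algebra.adjoin K {F}) x := by
    have : Algebra.adjoin K {F, G} ≤
        (integralClosure (Algebra.adjoin K {F}) S).restrictScalars K := by
      rw [Algebra.adjoin_le_iff]
      rintro y (rfl | rfl)
      · exact isIntegral_algebraMap
          (x := (⟨y, Algebra.self_mem_adjoin_singleton K y⟩ : Algebra.adjoin K {y}))
      · exact hG
    exact this hx
  have hmap (x : K[X]) (hx : x ∈ Algebra.adjoin K {φ F, φ G}) :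
      ∃ y ∈ Algebra.adjoin K {F, G}, φ y = x := by
    rw [← Set.image_pair, ← AlgHom.map_adjoin] at hx
    exact hx
  rcases mem_adjoin_or_exists_eq_X_mul hF
    (hG.map_of_forall_mem φ.toRingHom fun _ ↦ φ.apply_mem_adjoin_singleton) with h | h
  · refine absurd ?_ hGF
    obtain ⟨q, hq⟩ := (Algebra.adjoin_singleton_eq_range_aeval K (φ F) ▸ h :)
    have hq' : φ (aeval F q) = φ G := by rw [← aeval_algHom_apply]; exact hq
    have hmem : aeval F q ∈ Algebra.adjoin K {F} := aeval_mem_adjoin_singleton K F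
    have := hker (G - aeval F q)
      (hG.sub (isIntegral_algebraMap (x := (⟨_, hmem⟩ : Algebra.adjoin K {F}))))
      (by rw [map_sub, hq', sub_self])
    rwa [sub_eq_zero.mp this]
  obtain ⟨a, ha, b, hb, hb0, hab⟩ := h
  obtain ⟨r, hr, rfl⟩ := hmap a ha
  obtain ⟨s, hs, rfl⟩ := hmap b hb
  set f := φ F with hf
  have hs0 : s ≠ 0 := by rintro rfl; exact hb0 (map_zero φ)
  have hFm : F ∈ Algebra.adjoin K {F, G} := Algebra.subset_adjoin (Set.mem_insert _ _)
  have hhom : ∑ i ∈ Finset.range (f.natDegree + 1), f.coeff i • (r ^ i * s ^ (f.natDegree - i)) =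
      F * s ^ f.natDegree := by
    refine sub_eq_zero.mp (hker _ (hint _ (sub_mem (sum_mem fun i _ ↦ ?_) ?_)) ?_)
    · exact Subalgebra.smul_mem _ (mul_mem (pow_mem hr _) (pow_mem hs _)) _
    · exact mul_mem hFm (pow_mem hs _)
    · rw [map_sub, sub_eq_zero, map_mul, map_pow, ← hf, map_sum]
      have hexp : f * φ s ^ f.natDegree = (∑ i ∈ Finset.range (f.natDegree + 1),
          monomial i (f.coeff i)) * φ s ^ f.natDegree := by rw [← f.as_sum_range]
      rw [hexp, Finset.sum_mul]
      refine Finset.sum_congr rfl fun i hi ↦ ?_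
      rw [map_smul, map_mul, map_pow, map_pow, hab, ← C_mul_X_pow_eq_monomial, smul_eq_C_mul,
        mul_pow, mul_assoc, mul_assoc, ← pow_add,
        Nat.add_sub_cancel' (Nat.lt_succ_iff.mp (Finset.mem_range.mp hi))]
  let Q := FractionRing S
  have hinj : Function.Injective (algebraMap S Q) := IsFractionRing.injective S Q
  have hs0' : algebraMap S Q s ≠ 0 := by rwa [Ne, map_eq_zero_iff _ hinj]
  have hroot : aeval (algebraMap S Q r / algebraMap S Q s) f = algebraMap S Q F := by
    refine mul_right_cancel₀ (pow_ne_zero f.natDegree hs0') ?_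
    rw [← map_pow, ← map_mul, ← hhom, aeval_eq_sum_range, Finset.sum_mul, map_sum]
    refine Finset.sum_congr rfl fun i hi ↦ ?_
    obtain ⟨k, hk⟩ := Nat.exists_eq_add_of_le (Nat.lt_succ_iff.mp (Finset.mem_range.mp hi))
    rw [Algebra.smul_def, Algebra.smul_def, map_mul, ← IsScalarTower.algebraMap_apply, map_mul,
      map_pow, map_pow, map_pow, div_pow, hk, pow_add, Nat.add_sub_cancel_left]
    rw [mul_assoc, ← mul_assoc (_ / _), div_mul_cancel₀ _ (pow_ne_zero i hs0')]
  have hLint : IsIntegral S (algebraMap S Q r / algebraMap S Q s) := by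
    have hmon : (f * C f.leadingCoeff⁻¹).Monic := monic_mul_leadingCoeff_inv hF0
    have hdeg : 0 < (f * C f.leadingCoeff⁻¹).degree := by
      rw [degree_mul_leadingCoeff_inv _ hF0]
      exact natDegree_pos_iff_degree_pos.mp hF.pos
    refine ⟨(f * C f.leadingCoeff⁻¹).map (algebraMap K S) -
      C (F * algebraMap K S f.leadingCoeff⁻¹), ?_, ?_⟩
    · refine (hmon.map _).sub_of_left (degree_C_le.trans_lt ?_)
      rwa [hmon.degree_map]
    · rw [eval₂_sub, eval₂_C, eval₂_map, ← IsScalarTower.algebraMap_eq, eval₂_mul, eval₂_C,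
        map_mul, ← IsScalarTower.algebraMap_apply, ← aeval_def, hroot, sub_self]
  obtain ⟨L, hL⟩ := IsIntegrallyClosed.isIntegral_iff.mp hLint
  refine ⟨L, hinj ?_⟩
  rw [← aeval_algebraMap_apply, hL, hroot]

namespace MvPolynomial

theorem exists_pderiv_eq_C_mul_of_dvd {σ K : Type*} [Field K] [CharZero K] {F d : MvPolynomial σ K}
    (hF : F.totalDegree ≠ 0) (hd : ∀ i, d ∣ pderiv i F)
    (hdeg : F.totalDegree ≤ d.totalDegree + 1) :
    ∃ c : σ → K, (∃ k, c k ≠ 0) ∧ ∀ i, pderiv i F = C (c i) * d := by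
  have hc (i : σ) : ∃ c, pderiv i F = C c * d := by
    obtain ⟨e, he⟩ := hd i
    by_cases h0 : pderiv i F = 0
    · exact ⟨0, by rw [h0, C_0, zero_mul]⟩
    have hlt := totalDegree_pderiv_lt hF i
    rw [he] at h0
    rw [he, totalDegree_mul_of_isDomain (left_ne_zero_of_mul h0) (right_ne_zero_of_mul h0)] at hlt
    refine ⟨coeff 0 e, ?_⟩
    rw [← totalDegree_eq_zero_iff_eq_C.mp (by omega : e.totalDegree = 0), he, mul_comm]
  choose c hc using hc
  refine ⟨c, ?_, hc⟩
  by_contra! h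
  refine hF ?_
  rw [eq_C_of_forall_pderiv_eq_zero (F := F) fun i ↦ by rw [hc, h, C_0, zero_mul], totalDegree_C]

theorem map_algebraMap_polynomial_aeval {R K σ : Type*} [CommRing R] [CommRing K] [Algebra R K]
    (f : MvPolynomial σ R) (q : Polynomial R) :
    map (algebraMap R K) (Polynomial.aeval f q) =
      Polynomial.aeval (map (algebraMap R K) f) (q.map (algebraMap R K)) := by
  rw [Polynomial.aeval_def, Polynomial.hom_eval₂, Polynomial.aeval_def, Polynomial.eval₂_map]
  congr 1
  ext x
  simp [algebraMap_eq]

theorem totalDegree_map_of_injective {R K σ : Type*} [CommRing R] [CommRing K] (f : MvPolynomial σ R)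
    {φ : R →+* K} (hφ : Function.Injective φ) : (map φ f).totalDegree = f.totalDegree := by
  rw [totalDegree, support_map_of_injective f hφ, totalDegree]

theorem exists_isIntegral_notMem_adjoin_of_eq_aeval_linear {R K σ : Type*} [CommRing R] [IsDomain R]
    [Field K] [Algebra R K] [IsFractionRing R K] [Fintype σ] {f : MvPolynomial σ R}
    (hf : 2 ≤ f.totalDegree) (γ : σ → R) (u : Polynomial K)
    (hu : map (algebraMap R K) f = Polynomial.aeval (∑ i, C (algebraMap R K (γ i)) * X i) u) :
    ∃ g : MvPolynomial σ R,
      IsIntegral (Algebra.adjoin R {f}) g ∧ g ∉ Algebra.adjoin R {f} := by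
  have hinj : Function.Injective (algebraMap R K) := IsFractionRing.injective R K
  obtain ⟨b, hbmem, hb⟩ := IsLocalization.integerNormalization_spec (nonZeroDivisors R) u
  set U := IsLocalization.integerNormalization (nonZeroDivisors R) u
  set L : MvPolynomial σ R := ∑ i, C (γ i) * X i with hL
  have hmapL : map (algebraMap R K) L = ∑ i, C (algebraMap R K (γ i)) * X i := by
    simp [hL]
  have hUL : Polynomial.aeval L U = C b * f := by
    refine map_injective _ hinj ?_
    rw [map_algebraMap_polynomial_aeval, hb, hmapL, map_mul, map_C, hu, Algebra.smul_def, map_mul]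
    simp [IsScalarTower.algebraMap_apply R K (Polynomial K), algebraMap_eq]
  have hb0 : b ≠ 0 := nonZeroDivisors.ne_zero hbmem
  have hf0 : f ≠ 0 := by rintro rfl; simp at hf
  have hdeg : U.natDegree * L.totalDegree = f.totalDegree := by
    rw [← totalDegree_polynomial_aeval, hUL,
      totalDegree_mul_of_isDomain (C_ne_zero.mpr hb0) hf0, totalDegree_C, zero_add]
  have hUdeg : 0 < U.natDegree := Nat.pos_of_ne_zero fun h ↦ by rw [h, zero_mul] at hdeg; omega
  have hU0 : U ≠ 0 := by intro h; rw [h] at hUdeg; simp at hUdeg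
  have hLpos : 0 < L.totalDegree :=
    Nat.pos_of_ne_zero fun h ↦ by rw [h, mul_zero] at hdeg; omega
  have hL0 : L ≠ 0 := by intro h; rw [h] at hLpos; simp at hLpos
  have hLle : L.totalDegree ≤ 1 := by
    refine totalDegree_finsetSum_le fun i _ ↦ (totalDegree_mul _ _).trans ?_
    rw [totalDegree_C, totalDegree_X]
  refine ⟨U.leadingCoeff • L, ?_, fun hmem ↦ ?_⟩
  · let A := Algebra.adjoin R {f}
    have hfA : C b * f ∈ A := by
      rw [← smul_eq_C_mul]
      exact A.smul_mem (Algebra.self_mem_adjoin_singleton R f) _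
    have hAinj : Function.Injective (algebraMap R A) := FaithfulSMul.algebraMap_injective R A
    let P : Polynomial A := U.map (algebraMap R A) - Polynomial.C ⟨_, hfA⟩
    have hlt : (Polynomial.C (⟨_, hfA⟩ : A)).degree < (U.map (algebraMap R A)).degree := by
      refine Polynomial.degree_C_le.trans_lt ?_
      rw [Polynomial.degree_map_eq_of_injective hAinj]
      exact Polynomial.natDegree_pos_iff_degree_pos.mp hUdeg
    have hlc : P.leadingCoeff = algebraMap R A U.leadingCoeff := by
      rw [Polynomial.leadingCoeff_sub_of_degree_lt hlt,
        Polynomial.leadingCoeff_map_of_injective hAinj]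
    have hroot : Polynomial.aeval L P = 0 := by
      rw [Polynomial.aeval_sub, Polynomial.aeval_map_algebraMap, hUL, Polynomial.aeval_C, sub_eq_zero]
      rfl
    have := isIntegral_leadingCoeff_smul P L hroot
    rwa [hlc, algebraMap_smul] at this
  · obtain ⟨w, hw⟩ := (Algebra.adjoin_singleton_eq_range_aeval R f ▸ hmem :)
    have h1 := totalDegree_polynomial_aeval f w
    have h2 : Polynomial.aeval f w = U.leadingCoeff • L := hw
    rw [h2, smul_eq_C_mul, totalDegree_mul_of_isDomain
      (C_ne_zero.mpr (Polynomial.leadingCoeff_ne_zero.mpr hU0)) hL0, totalDegree_C, zero_add] at h1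
    have := Nat.le_of_dvd hLpos (Dvd.intro_left _ h1.symm)
    omega

theorem exists_eq_aeval_linear_of_isIntegral {σ K : Type*} [Field K] [Infinite K]
    {F G : MvPolynomial σ K} (hF : F.totalDegree.Prime)
    (hG : IsIntegral (Algebra.adjoin K {F}) G) (hGF : G ∉ Algebra.adjoin K {F}) :
    ∃ (L : MvPolynomial σ K) (u : Polynomial K),
      L.totalDegree = 1 ∧ u.natDegree = F.totalDegree ∧ F = Polynomial.aeval L u := by
  have hF0 : F ≠ 0 := by rintro rfl; exact hF.ne_zero totalDegree_zero
  obtain ⟨c, hc⟩ := exists_natDegree_aeval_C_mul_X_eq hF0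
  obtain ⟨L, hL⟩ := exists_aeval_eq_of_isIntegral_adjoin _ (hc ▸ hF) hG hGF
  refine ⟨L, _, ?_, hc, hL.symm⟩
  have := totalDegree_polynomial_aeval L (aeval (fun i ↦ Polynomial.C (c i) * Polynomial.X) F)
  rw [hL, hc] at this
  exact (Nat.mul_eq_left hF.ne_zero).mp this.symm

theorem _root_.IsIntegral.mvPolynomial_map {R K σ : Type*} [CommRing R] [CommRing K] [Algebra R K]
    {f g : MvPolynomial σ R} (hg : IsIntegral (Algebra.adjoin R {f}) g) :
    IsIntegral (Algebra.adjoin K {map (algebraMap R K) f}) (map (algebraMap R K) g) := by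
  refine hg.map_of_forall_mem _ fun x hx ↦ ?_
  obtain ⟨q, rfl⟩ := (Algebra.adjoin_singleton_eq_range_aeval R f ▸ hx :)
  rw [Algebra.adjoin_singleton_eq_range_aeval]
  exact ⟨q.map (algebraMap R K), (map_algebraMap_polynomial_aeval f q).symm⟩

end MvPolynomial


open MvPolynomial

/-- **Theorem 2.5.** Let `R` be an integral domain of characteristic zero and
`f ∈ R[x_1,…,x_n]` non-constant of prime total degree with `Q(R)[f] ∩ R[X] = R[f]`.
Then `f` is a closed polynomial iff `deg f̂ < deg f - 1`, where `f̂` is a gcd of the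
partial derivatives of `f` computed in `Q(R)[x_1,…,x_n]`. -/
theorem closed_iff_totalDegree_gcd_partials_lt
    (R : Type*) [CommRing R] [IsDomain R] [CharZero R] (n : ℕ)
    (f : MvPolynomial (Fin n) R)
    (hf : ∀ r : R, f ≠ C r)
    (hprime : Nat.Prime f.totalDegree)
    (hcap : ∀ g : MvPolynomial (Fin n) R,
      MvPolynomial.map (algebraMap R (FractionRing R)) g ∈
          Algebra.adjoin (FractionRing R)
            {MvPolynomial.map (algebraMap R (FractionRing R)) f} →
        g ∈ Algebra.adjoin R {f})
    (d : MvPolynomial (Fin n) (FractionRing R))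
    (hd1 : ∀ i : Fin n,
      d ∣ pderiv i (MvPolynomial.map (algebraMap R (FractionRing R)) f))
    (hd2 : ∀ e : MvPolynomial (Fin n) (FractionRing R),
      (∀ i : Fin n, e ∣ pderiv i (MvPolynomial.map (algebraMap R (FractionRing R)) f)) →
        e ∣ d) :
    (∀ g : MvPolynomial (Fin n) R,
        IsIntegral (Algebra.adjoin R {f}) g → g ∈ Algebra.adjoin R {f})
      ↔ d.totalDegree + 1 < f.totalDegree := by
  let K := FractionRing R
  have hinj : Function.Injective (algebraMap R K) := IsFractionRing.injective R K
  have : CharZero K := charZero_of_injective_algebraMap hinj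
  set F := MvPolynomial.map (algebraMap R K) f with hF
  have hdegF : F.totalDegree = f.totalDegree := totalDegree_map_of_injective f hinj
  have hF0 : F.totalDegree ≠ 0 := hdegF ▸ hprime.ne_zero
  constructor
  · intro hclosed
    by_contra! hlt
    obtain ⟨c, ⟨k, hk⟩, hc⟩ := exists_pderiv_eq_C_mul_of_dvd hF0 hd1 (hdegF ▸ hlt)
    obtain ⟨b, hb⟩ := IsLocalization.exist_integer_multiples_of_finite (nonZeroDivisors R) c
    choose γ hγ using hb
    have hb0 : algebraMap R K b ≠ 0 := by
      rw [Ne, map_eq_zero_iff _ hinj]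
      exact nonZeroDivisors.ne_zero b.2
    have hγ' (i : Fin n) : algebraMap R K (γ i) = algebraMap R K b * c i := by
      rw [← Algebra.smul_def]; exact hγ i
    obtain ⟨u, hu⟩ := exists_eq_aeval_of_pderiv_eq_C_mul
      (fun i ↦ algebraMap R K (γ i)) (k := k) (by rw [hγ']; exact mul_ne_zero hb0 hk) F
      (C (algebraMap R K b)⁻¹ * d) fun i ↦ by
        rw [hc, hγ', ← mul_assoc, ← C_mul, mul_right_comm, mul_inv_cancel₀ hb0, one_mul]
    obtain ⟨g, hg, hgf⟩ := exists_isIntegral_notMem_adjoin_of_eq_aeval_linear hprime.two_le γ u hu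
    exact hgf (hclosed g hg)
  · intro hlt g hg
    by_contra hgf
    obtain ⟨L, u, hL, hu, hFL⟩ := exists_eq_aeval_linear_of_isIntegral (hdegF ▸ hprime)
      hg.mvPolynomial_map fun h ↦ hgf (hcap g h)
    have hdvd : Polynomial.aeval L (Polynomial.derivative u) ∣ d := hd2 _ fun i ↦ by
      rw [hF, hFL, pderiv_polynomial_aeval]
      exact dvd_mul_right _ _
    have hd0 : d ≠ 0 := by
      rintro rfl
      refine hF0 ?_
      rw [eq_C_of_forall_pderiv_eq_zero fun i ↦ zero_dvd_iff.mp (hd1 i), totalDegree_C]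
    have hle := totalDegree_le_of_dvd_of_isDomain hdvd hd0
    rw [totalDegree_polynomial_aeval, hL, mul_one, Polynomial.natDegree_derivative, hu,
      ← hF, hdegF] at hle
    omega
end

section
/- Let R = ℂ[x] and B = R[y,z,t] = ℂ[x,y,z,t], and let v_1 = y + x(xz + y(yt + z²)) ∈ B (the first Vénéreau polynomial). Then v_1 is a closed polynomial over R, i.e., the subring ℂ[x, v_1] is integrally closed in ℂ[x,y,z,t]. -/
open MvPolynomial

/-- A retract `A` of a domain `B` is integrally closed in `B`. -/
theorem mem_of_isIntegral_of_retraction {R B : Type*} [CommRing R] [CommRing B] [IsDomain B]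
    [Algebra R B] (A : Subalgebra R B) (φ : B →ₐ[R] B) (hmem : ∀ b, φ b ∈ A)
    (hfix : ∀ a ∈ A, φ a = a) {g : B} (hg : IsIntegral A g) : g ∈ A := by
  have hint : IsIntegral A (g - φ g) :=
    hg.sub (isIntegral_algebraMap (x := (⟨φ g, hmem g⟩ : A)))
  have hker : φ (g - φ g) = 0 := by rw [map_sub, hfix _ (hmem g), sub_self]
  suffices h : g - φ g = 0 by
    rw [sub_eq_zero.mp h]
    exact hmem g
  by_contra hne
  obtain ⟨p, hp, hroot⟩ := hint.isAlgebraic.exists_nonzero_coeff_and_aeval_eq_zero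
    (mem_nonZeroDivisors_of_ne_zero hne)
  refine hp (Subtype.ext ?_)
  have h0 := congrArg φ hroot
  rw [← Polynomial.divX_mul_X_add p] at h0
  simp only [map_add, map_mul, Polynomial.aeval_X, Polynomial.aeval_C, hker, mul_zero,
    zero_add, map_zero] at h0
  exact (hfix _ (SetLike.coe_mem _)).symm.trans h0

set_option synthInstance.maxHeartbeats 1000000 in
set_option maxHeartbeats 2000000 in
/-- **Example 2.3.** Let `R = ℂ[x]` and `B = R[y,z,t] = ℂ[x,y,z,t]`.  The first Vénéreau
polynomial `v₁ = y + x(xz + y(yt + z²))` is a closed polynomial over `R`, i.e. the subring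
`ℂ[x, v₁] = R[v₁]` is integrally closed in `B`.  Here `B` is realised as
`MvPolynomial (Fin 3) (Polynomial ℂ)` with `x = C Polynomial.X`, `y = X 0`, `z = X 1`,
`t = X 2`. -/
theorem venereau_v1_closed :
    ∀ g : MvPolynomial (Fin 3) (Polynomial ℂ),
      IsIntegral (Algebra.adjoin (Polynomial ℂ)
          {(X 0 + C Polynomial.X * (C Polynomial.X * X 1 + X 0 * (X 0 * X 2 + X 1 ^ 2)) :
            MvPolynomial (Fin 3) (Polynomial ℂ))}) g →
        g ∈ Algebra.adjoin (Polynomial ℂ)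
          {(X 0 + C Polynomial.X * (C Polynomial.X * X 1 + X 0 * (X 0 * X 2 + X 1 ^ 2)) :
            MvPolynomial (Fin 3) (Polynomial ℂ))} := by
  intro g hg
  set v : MvPolynomial (Fin 3) (Polynomial ℂ) :=
    X 0 + C Polynomial.X * (C Polynomial.X * X 1 + X 0 * (X 0 * X 2 + X 1 ^ 2)) with hv
  let φ : MvPolynomial (Fin 3) (Polynomial ℂ) →ₐ[Polynomial ℂ]
    MvPolynomial (Fin 3) (Polynomial ℂ) := aeval ![v, 0, 0]
  have hφv : φ v = v := by
    have h0 : φ (X 0) = v := by simp [φ]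
    have h1 : φ (X 1) = 0 := by simp [φ]
    have h2 : φ (X 2) = 0 := by simp [φ]
    rw [hv]
    simp only [map_add, map_mul, map_pow, h0, h1, h2]
    rw [← hv]
    ring
  refine mem_of_isIntegral_of_retraction _ φ (fun b => ?_) (fun a ha => ?_) hg
  · have hle : φ.range ≤ Algebra.adjoin (Polynomial ℂ) {v} := by
      rw [← Algebra.adjoin_range_eq_range_aeval]
      refine Algebra.adjoin_le ?_
      rintro _ ⟨i, rfl⟩
      fin_cases i
      · exact Algebra.self_mem_adjoin_singleton _ v
      · exact zero_mem _
      · exact zero_mem _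
    exact hle ⟨b, rfl⟩
  · have hle : Algebra.adjoin (Polynomial ℂ) {v} ≤ AlgHom.equalizer φ (AlgHom.id _ _) :=
      Algebra.adjoin_le (Set.singleton_subset_iff.mpr hφv)
    exact hle ha
end

section
/- Let k be an algebraically closed field of characteristic zero and let f ∈ k[x,y] be a non-constant polynomial which is factorially closed. Let Δ_f be the k-derivation on k[x,y] defined by Δ_f = −f_y ∂/∂x + f_x ∂/∂y. Then every Darboux polynomial of Δ_f lies in the kernel of Δ_f; that is, if g ∈ k[x,y] \ {0} satisfies Δ_f(g) = h·g for some h ∈ k[x,y], then Δ_f(g) = 0. -/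
open MvPolynomial

/-- A derivation of a domain of characteristic zero vanishes on every element that is algebraic
over the ring of constants. -/
theorem Derivation.eq_zero_of_isAlgebraic {B A : Type*} [CommRing B] [CommRing A] [IsDomain A]
    [Algebra B A] [CharZero A] [FaithfulSMul B A] (E : Derivation B A A) {a : A}
    (ha : IsAlgebraic B a) : E a = 0 := by
  have hinj := FaithfulSMul.algebraMap_injective B A
  have : IsDomain B := hinj.isDomain (algebraMap B A)
  have : CharZero B := ⟨fun m n hmn ↦ by
    have := congrArg (algebraMap B A) hmn
    simpa using this⟩
  obtain ⟨P, hP, hPa⟩ := ha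
  induction hn : P.natDegree using Nat.strong_induction_on generalizing P with
  | _ n ih =>
    have hn0 : P.natDegree ≠ 0 := fun h0 ↦ by
      rw [Polynomial.eq_C_of_natDegree_eq_zero h0, Polynomial.aeval_C] at hPa
      have := hinj (hPa.trans (map_zero _).symm)
      exact hP (by rw [Polynomial.eq_C_of_natDegree_eq_zero h0, this, Polynomial.C_0])
    have key := E.map_aeval P a
    rw [hPa, map_zero, smul_eq_mul, eq_comm, mul_eq_zero] at key
    refine key.elim (fun h ↦ ?_) id
    refine ih _ (hn ▸ Polynomial.natDegree_derivative_lt hn0) _ (fun h0 ↦ ?_) h rfl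
    have := IsAddTorsionFree.of_isTorsionFree ℕ B
    exact hn0 (Polynomial.derivative_eq_zero.1 h0)

/-- If `a` is a constant of a derivation, then so is every element of the subalgebra generated
by `a`. -/
theorem Derivation.eq_zero_of_mem_adjoin_singleton {R A M : Type*} [CommRing R] [CommRing A]
    [Algebra R A] [AddCommGroup M] [Module A M] [Module R M] (E : Derivation R A M) {a c : A}
    (ha : E a = 0) (hc : c ∈ Algebra.adjoin R {a}) : E c = 0 :=
  Derivation.eqOn_adjoin (D1 := E) (D2 := 0) (by simpa [Set.EqOn] using ha) hc

/-- If `a` is a constant of a derivation of a domain of characteristic zero, then the derivation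
vanishes on every element algebraic over the subalgebra generated by `a`. -/
theorem Derivation.eq_zero_of_isAlgebraic_adjoin {R A : Type*} [CommRing R] [CommRing A]
    [IsDomain A] [Algebra R A] [CharZero A] (E : Derivation R A A) {a b : A} (ha : E a = 0)
    (hb : IsAlgebraic (Algebra.adjoin R {a}) b) : E b = 0 := by
  let E' : Derivation (Algebra.adjoin R {a}) A A := Derivation.mk'
    { toFun := E
      map_add' := E.map_add
      map_smul' := fun c x ↦ by
        rw [Subalgebra.smul_def, smul_eq_mul, E.leibniz, E.eq_zero_of_mem_adjoin_singleton ha c.2]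
        simp [Subalgebra.smul_def] }
    (fun x y ↦ E.leibniz x y)
  exact E'.eq_zero_of_isAlgebraic hb

/-- Lifting an algebraically independent family along a homomorphism and adding a nonzero element
of the kernel yields an algebraically independent family. -/
theorem AlgebraicIndependent.option_of_comp {R A A' ι : Type*} [CommRing R] [CommRing A]
    [IsDomain A] [CommRing A'] [Algebra R A] [Algebra R A'] (φ : A →ₐ[R] A') {x : ι → A}
    (hx : AlgebraicIndependent R (φ ∘ x)) {p : A} (hp : p ≠ 0) (hφp : φ p = 0) :
    AlgebraicIndependent R (fun o : Option ι ↦ o.elim p x) := by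
  have hx' : AlgebraicIndependent R x := hx.of_comp φ
  rw [hx'.option_iff_transcendental]
  intro halg
  obtain ⟨q, hq0, hq⟩ :=
    halg.exists_nonzero_coeff_and_aeval_eq_zero (mem_nonZeroDivisors_of_ne_zero hp)
  obtain ⟨r, hr⟩ := Polynomial.X_dvd_sub_C (p := q)
  have hr' := congrArg (Polynomial.aeval p) hr
  rw [map_sub, hq, Polynomial.aeval_C, map_mul, Polynomial.aeval_X, zero_sub] at hr'
  have h0 : φ (q.coeff 0 : A) = 0 := by
    have := congrArg φ hr'
    rwa [map_mul, hφp, zero_mul, map_neg, neg_eq_zero] at this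
  obtain ⟨s, hs⟩ : ∃ s : MvPolynomial ι R, aeval x s = (q.coeff 0 : A) :=
    (Algebra.adjoin_range_eq_range_aeval R x).le (q.coeff 0).2
  have hs0 : s = 0 := hx.eq_zero_of_aeval_eq_zero s (by
    rwa [← hs, ← AlgHom.comp_apply, comp_aeval] at h0)
  exact hq0 (Subtype.ext (by rw [← hs, hs0, map_zero]; rfl))

namespace MvPolynomial

/-- In a proper quotient of the polynomial ring in two variables by a nonzero element, any
element is algebraic over the subalgebra generated by a transcendental one. -/
theorem isAlgebraic_adjoin_of_transcendental {k A : Type*} [Field k] [CommRing A] [Algebra k A]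
    {φ : MvPolynomial (Fin 2) k →ₐ[k] A} (hφ : Function.Surjective φ)
    {p : MvPolynomial (Fin 2) k} (hp : p ≠ 0) (hφp : φ p = 0) {a : A} (ha : Transcendental k a)
    (b : A) : IsAlgebraic (Algebra.adjoin k {a}) b := by
  by_contra hb
  have h1 : AlgebraicIndependent k (fun _ : Unit ↦ a) :=
    algebraicIndependent_unique_type_iff.2 ha
  have h2 : AlgebraicIndependent k (fun o : Option Unit ↦ o.elim b fun _ ↦ a) := by
    rw [h1.option_iff_transcendental, Set.range_const]
    exact hb
  have h3 : AlgebraicIndependent k (φ ∘ fun o : Option Unit ↦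
      Function.surjInv hφ (o.elim b fun _ ↦ a)) := by
    simpa [Function.comp_def, Function.surjInv_eq] using h2
  have hcard := (h3.option_of_comp φ hp hφp).lift_cardinalMk_le_trdeg
  rw [MvPolynomial.trdeg_of_isDomain] at hcard
  simp at hcard
  norm_num at hcard

theorem totalDegree_pderiv_lt_s12 {σ k : Type*} [CommSemiring k] {i : σ} {p : MvPolynomial σ k}
    (h : pderiv i p ≠ 0) : (pderiv i p).totalDegree < p.totalDegree := by
  have hsupp : ∀ m ∈ (pderiv i p).support, (m.sum fun _ e ↦ e) + 1 ≤ p.totalDegree := by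
    intro m hm
    have hm' : m + Finsupp.single i 1 ∈ p.support := by
      rw [mem_support_iff, coeff_pderiv] at hm
      exact mem_support_iff.2 (left_ne_zero_of_mul hm)
    have := le_totalDegree hm'
    rwa [Finsupp.sum_add_index' (fun _ ↦ rfl) (fun _ _ _ ↦ rfl),
      Finsupp.sum_single_index rfl] at this
  obtain ⟨m, hm⟩ := support_nonempty.2 h
  have := hsupp m hm
  rw [totalDegree, Finset.sup_lt_iff (by simpa using by omega)]
  exact fun m hm ↦ hsupp m hm

theorem pderiv_eq_zero_of_dvd {σ k : Type*} [CommRing k] [IsDomain k] {i : σ}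
    {p : MvPolynomial σ k} (h : p ∣ pderiv i p) : pderiv i p = 0 := by
  by_contra h0
  obtain ⟨q, hq⟩ := h
  have hp : p ≠ 0 := by rintro rfl; simp at h0
  have hq0 : q ≠ 0 := by rintro rfl; simp [hq] at h0
  have h1 := totalDegree_pderiv_lt_s12 h0
  rw [hq, totalDegree_mul_of_isDomain hp hq0] at h1
  omega

theorem eq_C_of_pderiv_eq_zero {σ k : Type*} [Field k] [CharZero k] {p : MvPolynomial σ k}
    (h : ∀ i, pderiv i p = 0) : p = C (coeff 0 p) := by
  classical
  ext m
  rw [coeff_C]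
  split_ifs with hm
  · rw [hm]
  obtain ⟨i, hi⟩ : ∃ i, m i ≠ 0 := by
    by_contra! h0
    exact hm (Finsupp.ext h0).symm
  have := coeff_pderiv (i := i) p (m - Finsupp.single i 1)
  rw [h i, coeff_zero, tsub_add_cancel_of_le (by simpa [Nat.one_le_iff_ne_zero] using hi), eq_comm,
    mul_eq_zero] at this
  exact this.resolve_right (Nat.cast_add_one_ne_zero _)

/-- The Hamiltonian derivation `-f_y ∂x + f_x ∂y` of `k[x, y]`. -/
noncomputable def hamiltonianDerivation {k : Type*} [CommRing k] (f : MvPolynomial (Fin 2) k) :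
    Derivation k (MvPolynomial (Fin 2) k) (MvPolynomial (Fin 2) k) :=
  (-(pderiv 1 f) : MvPolynomial (Fin 2) k) • pderiv 0
    + (pderiv 0 f : MvPolynomial (Fin 2) k) • pderiv 1

section Hamiltonian

variable {k : Type*} [CommRing k] (f g : MvPolynomial (Fin 2) k)

theorem hamiltonianDerivation_apply :
    hamiltonianDerivation f g = -(pderiv 1 f) * pderiv 0 g + pderiv 0 f * pderiv 1 g := rfl

theorem hamiltonianDerivation_self : hamiltonianDerivation f f = 0 := by
  rw [hamiltonianDerivation_apply]; ring

theorem hamiltonianDerivation_swap :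
    hamiltonianDerivation g f = -hamiltonianDerivation f g := by
  simp only [hamiltonianDerivation_apply]; ring

end Hamiltonian

/-- A polynomial `f` is constant along every invariant irreducible curve of its Hamiltonian
derivation. -/
theorem exists_dvd_sub_C_of_dvd_hamiltonianDerivation {k : Type*} [Field k] [IsAlgClosed k]
    [CharZero k] {f p : MvPolynomial (Fin 2) k} (hp : Prime p)
    (h : p ∣ hamiltonianDerivation f p) : ∃ c : k, p ∣ f - C c := by
  let I : Ideal (MvPolynomial (Fin 2) k) := Ideal.span {p}
  have : I.IsPrime := (Ideal.span_singleton_prime hp.ne_zero).2 hp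
  let φ := Ideal.Quotient.mkₐ k I
  have hφ : Function.Surjective φ := Ideal.Quotient.mkₐ_surjective k I
  have hφ0 : ∀ q, φ q = 0 ↔ p ∣ q := fun q ↦
    Ideal.Quotient.eq_zero_iff_mem.trans Ideal.mem_span_singleton
  have : CharZero (MvPolynomial (Fin 2) k ⧸ I) := algebraRat.charZero _
  by_cases halg : IsAlgebraic k (φ f)
  · obtain ⟨c, hc⟩ := minpoly.mem_range_of_degree_eq_one k (φ f)
      (IsAlgClosed.degree_eq_one_of_irreducible k (minpoly.irreducible halg.isIntegral))
    refine ⟨c, (hφ0 _).1 ?_⟩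
    rw [map_sub, ← hc, sub_eq_zero]
    exact (φ.commutes c).symm
  · exfalso
    have hd : ∀ q, φ q = 0 → φ (hamiltonianDerivation p q) = 0 := by
      intro q hq
      rw [hφ0] at hq ⊢
      obtain ⟨r, rfl⟩ := hq
      rw [Derivation.leibniz, hamiltonianDerivation_self, smul_zero, add_zero]
      exact dvd_mul_right _ _
    let E := Derivation.liftOfSurjective hφ hd
    have hE : ∀ q, E (φ q) = φ (hamiltonianDerivation p q) :=
      Derivation.liftOfSurjective_apply hφ hd
    have hEf : E (φ f) = 0 := by
      rw [hE, hφ0, hamiltonianDerivation_swap]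
      exact (dvd_neg).2 h
    have hdvd : ∀ q, p ∣ hamiltonianDerivation p q := fun q ↦ by
      rw [← hφ0, ← hE]
      exact E.eq_zero_of_isAlgebraic_adjoin hEf
        (isAlgebraic_adjoin_of_transcendental hφ hp.ne_zero ((hφ0 p).2 dvd_rfl) halg _)
    have h1 : pderiv 1 p = 0 := pderiv_eq_zero_of_dvd (by
      simpa [hamiltonianDerivation_apply] using hdvd (X 0))
    have h0 : pderiv 0 p = 0 := pderiv_eq_zero_of_dvd (by
      simpa [hamiltonianDerivation_apply] using hdvd (X 1))
    have hC := eq_C_of_pderiv_eq_zero (p := p) (fun i ↦ by fin_cases i <;> assumption)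
    refine hp.not_isUnit (hC ▸ (IsUnit.mk0 _ fun hc ↦ hp.ne_zero ?_).map C)
    rw [hC, hc, C_0]

end MvPolynomial

/-- In characteristic zero, prime divisors of Darboux elements are Darboux elements. -/
theorem Derivation.prime_dvd_apply_of_dvd {k R : Type*} [Field k] [CharZero k] [CommRing R]
    [IsDomain R] [WfDvdMonoid R] [Algebra k R] (D : Derivation k R R) {g p : R} (hg : g ≠ 0)
    (hDg : g ∣ D g) (hp : Prime p) (hpg : p ∣ g) : p ∣ D p := by
  obtain ⟨n, m, hpm, rfl⟩ := WfDvdMonoid.max_power_factor hg hp.irreducible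
  obtain _ | n := n
  · simp only [pow_zero, one_mul] at hpg
    exact absurd hpg hpm
  have h1 : p ^ (n + 1) ∣ D (p ^ (n + 1) * m) := (dvd_mul_right _ _).trans hDg
  have h2 : D (p ^ (n + 1) * m) = p ^ (n + 1) * D m + p ^ n * (((n + 1 : ℕ) : R) * m * D p) := by
    rw [D.leibniz, D.leibniz_pow]
    simp only [smul_eq_mul, nsmul_eq_mul, Nat.add_sub_cancel]
    ring
  rw [h2, dvd_add_right (dvd_mul_right _ _), pow_succ,
    mul_dvd_mul_iff_left (pow_ne_zero _ hp.ne_zero)] at h1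
  refine (hp.dvd_or_dvd h1).resolve_left fun h ↦ (hp.dvd_or_dvd h).elim (fun hn ↦ ?_) hpm
  have hu : IsUnit ((n + 1 : ℕ) : R) := by
    rw [← _root_.map_natCast (algebraMap k R)]
    exact (IsUnit.mk0 _ (Nat.cast_ne_zero.2 n.succ_ne_zero)).map _
  exact hp.not_isUnit (isUnit_of_dvd_unit hn hu)

/-- **Proposition 2.8.** Let `k` be an algebraically closed field of characteristic zero and
`f ∈ k[x,y]` a non-constant factorially closed polynomial.  Then the Hamiltonian derivation
`Δ_f = -f_y ∂x + f_x ∂y` has no Darboux polynomials other than elements of its kernel: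
every nonzero `g` with `Δ_f g = h g` for some `h` satisfies `Δ_f g = 0`. -/
theorem darboux_of_factoriallyClosed_mem_kernel
    (k : Type*) [Field k] [IsAlgClosed k] [CharZero k]
    (f : MvPolynomial (Fin 2) k) (hf : ∀ c : k, f ≠ C c)
    (hfc : ∀ g h : MvPolynomial (Fin 2) k, g ≠ 0 → h ≠ 0 → g * h ∈ Algebra.adjoin k {f} →
      g ∈ Algebra.adjoin k {f} ∧ h ∈ Algebra.adjoin k {f})
    (D : Derivation k (MvPolynomial (Fin 2) k) (MvPolynomial (Fin 2) k))
    (hD : D = (-(pderiv 1 f) : MvPolynomial (Fin 2) k) • pderiv 0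
              + (pderiv 0 f : MvPolynomial (Fin 2) k) • pderiv 1)
    (g : MvPolynomial (Fin 2) k) (hg : g ≠ 0)
    (hdarboux : ∃ h : MvPolynomial (Fin 2) k, D g = h * g) :
    D g = 0 := by
  replace hD : D = hamiltonianDerivation f := hD
  subst hD
  obtain ⟨h, hh⟩ := hdarboux
  have hprime : ∀ p, Prime p → p ∣ g → hamiltonianDerivation f p = 0 := by
    intro p hp hpg
    obtain ⟨c, q, hq⟩ := exists_dvd_sub_C_of_dvd_hamiltonianDerivation hp
      ((hamiltonianDerivation f).prime_dvd_apply_of_dvd hg ⟨h, by rw [hh, mul_comm]⟩ hp hpg)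
    have hq0 : q ≠ 0 := by
      rintro rfl
      exact hf c (sub_eq_zero.1 (by rw [hq, mul_zero]))
    have hmem : p * q ∈ Algebra.adjoin k {f} := hq ▸ sub_mem
      (Algebra.self_mem_adjoin_singleton k f) (Subalgebra.algebraMap_mem _ c)
    exact (hamiltonianDerivation f).eq_zero_of_mem_adjoin_singleton
      (hamiltonianDerivation_self f) (hfc p q hp.ne_zero hq0 hmem).1
  clear hh hg
  induction g using UniqueFactorizationMonoid.induction_on_prime with
  | h₁ => exact map_zero _
  | h₂ u hu =>
    obtain ⟨c, -, rfl⟩ := MvPolynomial.isUnit_iff_eq_C_of_isReduced.1 hu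
    exact (hamiltonianDerivation f).map_algebraMap c
  | h₃ a p _ hp ih =>
    rw [Derivation.leibniz, hprime p hp (dvd_mul_right _ _),
      ih fun q hq hqa ↦ hprime q hq (hqa.mul_left p), smul_zero, smul_zero, add_zero]
end
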